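/- Let 0 < p ≤ 1 and 0 < q ≤ 1, let X be a real vector space equipped with a p-norm ‖·‖_X and Y a real vector space equipped with a q-norm ‖·‖_Y, and let α > 0. Then there exists a constant γ > 0, depending only on α, p and q, such that for every bounded linear operator T : X → Y and every n ∈ ℕ, sup_{1 ≤ k ≤ n} k^α e_k(T) ≤ γ · sup_{1 ≤ k ≤ n} k^α c_k(T). -/

import Mathlib

/-- A `p`-norm on a real vector space `X` (for `0 < p ≤ 1`): positive definite,
absolutely homogeneous, and satisfying the `p`-triangle inequality. -/
structure IsPNorm {X : Type*} [AddCommGroup X] [Module ℝ X] (p : ℝ) (N : X → ℝ) : Prop where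
  nonneg : ∀ x, 0 ≤ N x
  eq_zero_iff : ∀ x, N x = 0 ↔ x = 0
  smul_eq : ∀ (a : ℝ) (x : X), N (a • x) = |a| * N x
  padd : ∀ x y, N (x + y) ^ p ≤ N x ^ p + N y ^ p

/-- The `k`-th entropy number of a linear operator `T : X → Y` between quasi-normed
spaces: the infimum of all `ε > 0` such that `T(B_X)` can be covered by `2^(k-1)`
open `ε`-balls in `Y`. -/
noncomputable def entropyNumber {X Y : Type*} [AddCommGroup X] [Module ℝ X]
    [AddCommGroup Y] [Module ℝ Y] (NX : X → ℝ) (NY : Y → ℝ)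
    (T : X →ₗ[ℝ] Y) (k : ℕ) : ℝ :=
  sInf {ε : ℝ | 0 < ε ∧ ∃ c : Fin (2 ^ (k - 1)) → Y,
    ∀ x : X, NX x < 1 → ∃ i, NY (T x - c i) < ε}

/-- The `k`-th Gelfand number of a linear operator `T : X → Y`: the infimum over
subspaces `M ⊆ X` of codimension `< k` of `sup {‖Tx‖_Y : x ∈ M, ‖x‖_X ≤ 1}`
(encoded as the infimum of all upper bounds `r` valid for some such `M`). -/
noncomputable def gelfandNumber {X Y : Type*} [AddCommGroup X] [Module ℝ X]
    [AddCommGroup Y] [Module ℝ Y] (NX : X → ℝ) (NY : Y → ℝ)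
    (T : X →ₗ[ℝ] Y) (k : ℕ) : ℝ :=
  sInf {r : ℝ | ∃ M : Submodule ℝ X, Module.rank ℝ (X ⧸ M) < (k : Cardinal) ∧
    ∀ x ∈ M, NX x ≤ 1 → NY (T x) ≤ r}

namespace CarlQB

variable {X Y : Type*} [AddCommGroup X] [Module ℝ X] [AddCommGroup Y] [Module ℝ Y]

lemma pn_zero {p : ℝ} {N : X → ℝ} (h : IsPNorm p N) : N 0 = 0 := (h.eq_zero_iff 0).2 rfl

lemma pn_neg {p : ℝ} {N : X → ℝ} (h : IsPNorm p N) (x : X) : N (-x) = N x := by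
  have := h.smul_eq (-1) x
  simpa using this

lemma pn_add_lt {p : ℝ} (hp : 0 < p) {N : X → ℝ} (h : IsPNorm p N) {x y : X} {t : ℝ} (ht : 0 ≤ t)
    (hxy : N x ^ p + N y ^ p < t ^ p) : N (x + y) < t :=
  (Real.rpow_lt_rpow_iff (h.nonneg _) ht hp).1 ((h.padd x y).trans_lt hxy)

lemma pn_add_le {p : ℝ} (hp : 0 < p) {N : X → ℝ} (h : IsPNorm p N) {x y : X} {t : ℝ} (ht : 0 ≤ t)
    (hxy : N x ^ p + N y ^ p ≤ t ^ p) : N (x + y) ≤ t :=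
  (Real.rpow_le_rpow_iff (h.nonneg _) ht hp).1 ((h.padd x y).trans hxy)

lemma pn_sum {p : ℝ} (hp : 0 < p) {N : X → ℝ} (h : IsPNorm p N) {ι : Type*} (s : Finset ι)
    (g : ι → X) : N (∑ i ∈ s, g i) ^ p ≤ ∑ i ∈ s, N (g i) ^ p := by
  classical
  induction s using Finset.induction_on with
  | empty => simp [pn_zero h, Real.zero_rpow hp.ne']
  | insert a s ha ih =>
    rw [Finset.sum_insert ha, Finset.sum_insert ha]
    exact (h.padd _ _).trans (by gcongr)

lemma small_lift {p : ℝ} (hp : 0 < p) {N : X → ℝ} (h : IsPNorm p N) {d : ℕ}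
    (f : X →ₗ[ℝ] (Fin d → ℝ)) (hf : Function.Surjective f) {η : ℝ} (hη : 0 < η) :
    ∃ δ > 0, ∀ w : Fin d → ℝ, ‖w‖ < δ → ∃ z, f z = w ∧ N z < η := by
  choose x hx using fun i : Fin d => hf (Pi.single i 1)
  set S := ∑ i, N (x i) ^ p with hS
  have hS0 : 0 ≤ S := Finset.sum_nonneg fun i _ => Real.rpow_nonneg (h.nonneg _) _
  have hηp : 0 < η ^ p := Real.rpow_pos_of_pos hη _
  have hq : 0 < η ^ p / (S + 1) := by positivity
  refine ⟨(η ^ p / (S + 1)) ^ (1 / p), Real.rpow_pos_of_pos hq _, fun w hw => ?_⟩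
  refine ⟨∑ i, w i • x i, ?_, ?_⟩
  · rw [map_sum]
    simp only [map_smul, hx]
    ext j
    simp [Finset.sum_apply, Pi.single_apply]
  · refine (Real.rpow_lt_rpow_iff (h.nonneg _) hη.le hp).1 ?_
    refine (pn_sum hp h _ _).trans_lt ?_
    have h1 : ∀ i, N (w i • x i) ^ p ≤ (η ^ p / (S + 1)) * N (x i) ^ p := by
      intro i
      rw [h.smul_eq, Real.mul_rpow (abs_nonneg _) (h.nonneg _)]
      gcongr
      · exact Real.rpow_nonneg (h.nonneg _) _
      have h2 : |w i| ≤ (η ^ p / (S + 1)) ^ (1 / p) := by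
        have := norm_le_pi_norm w i
        rw [Real.norm_eq_abs] at this
        exact this.trans hw.le
      calc |w i| ^ p ≤ ((η ^ p / (S + 1)) ^ (1 / p)) ^ p := by gcongr
        _ = _ := by rw [← Real.rpow_mul hq.le, one_div_mul_cancel hp.ne', Real.rpow_one]
    calc ∑ i, N (w i • x i) ^ p ≤ ∑ i, (η ^ p / (S + 1)) * N (x i) ^ p :=
          Finset.sum_le_sum fun i _ => h1 i
      _ = (η ^ p / (S + 1)) * S := by rw [← Finset.mul_sum]
      _ < η ^ p := by
        rw [div_mul_eq_mul_div, div_lt_iff₀ (by positivity)]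
        nlinarith

/-- The auxiliary bounded neighbourhoods. -/
def W (N : X → ℝ) {d : ℕ} (f : X →ₗ[ℝ] (Fin d → ℝ)) (R t : ℝ) : Set (Fin d → ℝ) :=
  {v | ‖v‖ < R * t ∧ ∃ x, f x = v ∧ N x < t}

lemma W_open {p : ℝ} (hp : 0 < p) {N : X → ℝ} (h : IsPNorm p N) {d : ℕ}
    (f : X →ₗ[ℝ] (Fin d → ℝ)) (hf : Function.Surjective f) (R : ℝ) {t : ℝ} (ht : 0 < t) :
    IsOpen (W N f R t) := by
  refine IsOpen.inter (isOpen_lt continuous_norm continuous_const) ?_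
  refine Metric.isOpen_iff.2 ?_
  rintro v ⟨x, rfl, hx⟩
  have hlt : N x ^ p < t ^ p := Real.rpow_lt_rpow (h.nonneg _) hx hp
  have h0 : 0 < t ^ p - N x ^ p := sub_pos.2 hlt
  obtain ⟨δ, hδ, H⟩ := small_lift hp h f hf (Real.rpow_pos_of_pos h0 (1 / p))
  refine ⟨δ, hδ, fun w hw => ?_⟩
  obtain ⟨z, hz, hz'⟩ := H (w - f x) (by rwa [← dist_eq_norm])
  refine ⟨x + z, by rw [map_add, hz]; abel, pn_add_lt hp h ht.le ?_⟩
  have := Real.rpow_lt_rpow (h.nonneg _) hz' hp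
  rw [← Real.rpow_mul h0.le, one_div_mul_cancel hp.ne', Real.rpow_one] at this
  linarith

lemma W_smul {p : ℝ} {N : X → ℝ} (h : IsPNorm p N) {d : ℕ}
    (f : X →ₗ[ℝ] (Fin d → ℝ)) (R : ℝ) {t : ℝ} (ht : 0 < t) :
    W N f R t = (fun v => t • v) '' W N f R 1 := by
  ext v
  constructor
  · rintro ⟨hv, x, rfl, hx⟩
    refine ⟨t⁻¹ • f x, ⟨?_, t⁻¹ • x, map_smul _ _ _, ?_⟩, ?_⟩
    · rw [norm_smul, Real.norm_eq_abs, abs_of_pos (inv_pos.2 ht), inv_mul_lt_iff₀ ht]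
      linarith
    · rw [h.smul_eq, abs_of_pos (inv_pos.2 ht), inv_mul_lt_iff₀ ht]
      linarith
    · simp [smul_smul, ht.ne']
  · rintro ⟨v, ⟨hv, x, rfl, hx⟩, rfl⟩
    refine ⟨?_, t • x, map_smul _ _ _, ?_⟩
    · simp only
      rw [norm_smul, Real.norm_eq_abs, abs_of_pos ht]
      nlinarith
    · rw [h.smul_eq, abs_of_pos ht]
      nlinarith

lemma W_vol {p : ℝ} {N : X → ℝ} (h : IsPNorm p N) {d : ℕ}
    (f : X →ₗ[ℝ] (Fin d → ℝ)) (R : ℝ) {t : ℝ} (ht : 0 < t) :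
    MeasureTheory.volume (W N f R t) = ENNReal.ofReal (t ^ d) * MeasureTheory.volume (W N f R 1) := by
  rw [W_smul h f R ht]
  have := MeasureTheory.Measure.addHaar_smul (MeasureTheory.volume : MeasureTheory.Measure (Fin d → ℝ))
    t (W N f R 1)
  rw [Set.image_smul, this]
  simp [abs_of_pos ht]

lemma packing {p : ℝ} (hp : 0 < p) (hp1 : p ≤ 1) {N : X → ℝ} (h : IsPNorm p N) {d : ℕ}
    (f : X →ₗ[ℝ] (Fin d → ℝ)) (hf : Function.Surjective f) {ε : ℝ} (hε : 0 < ε) (hε1 : ε ≤ 1)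
    (s : Finset X) (hs : ∀ x ∈ s, N x < 1)
    (hsep : ∀ x ∈ s, ∀ y ∈ s, x ≠ y → ¬ ∃ z, N z < ε ∧ f z = f x - f y) :
    (s.card : ℝ) ≤ (2 ^ (2 / p) / ε) ^ d := by
  classical
  set τ : ℝ := 2 ^ (1 / p) with hτ
  have hτ2 : 2 ≤ τ := by
    have : (2:ℝ) ^ (1:ℝ) ≤ 2 ^ (1 / p) :=
      Real.rpow_le_rpow_of_exponent_le (by norm_num) (by rw [le_div_iff₀ hp]; linarith)
    rwa [Real.rpow_one] at this
  have hτp : τ ^ p = 2 := by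
    rw [hτ, ← Real.rpow_mul (by norm_num), one_div_mul_cancel hp.ne', Real.rpow_one]
  have hτ0 : 0 < τ := by linarith
  have hττ : (2:ℝ) ^ (2 / p) = τ * τ := by
    rw [hτ, ← Real.rpow_add (by norm_num)]; congr 1; ring
  set σ : ℝ := ε / τ with hσ
  have hσ0 : 0 < σ := by positivity
  have hσ1 : σ ≤ 1 := by rw [hσ, div_le_one hτ0]; linarith
  have hσp : σ ^ p + σ ^ p = ε ^ p := by
    rw [hσ, Real.div_rpow hε.le hτ0.le, hτp]; ring
  set R : ℝ := 1 + ∑ x ∈ s, ‖f x‖ with hR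
  have hR0 : 0 < R := by
    have : 0 ≤ ∑ x ∈ s, ‖f x‖ := Finset.sum_nonneg fun _ _ => norm_nonneg _
    linarith
  have hRx : ∀ x ∈ s, ‖f x‖ < R := fun x hx => by
    have := Finset.single_le_sum (f := fun x => ‖f x‖) (fun _ _ => norm_nonneg _) hx
    linarith
  let A : X → Set (Fin d → ℝ) := fun x => (fun v => v + -f x) ⁻¹' W N f R σ
  have hAo : ∀ x, IsOpen (A x) := fun x =>
    (W_open hp h f hf R hσ0).preimage (continuous_id.add continuous_const)
  have hAv : ∀ x, MeasureTheory.volume (A x) = MeasureTheory.volume (W N f R σ) := fun x =>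
    MeasureTheory.measure_preimage_add_right _ _ _
  have hdisj : (s : Set X).PairwiseDisjoint A := by
    intro x hx y hy hxy
    rw [Function.onFun, Set.disjoint_left]
    rintro v ⟨-, a, ha, ha'⟩ ⟨-, b, hb, hb'⟩
    refine hsep x hx y hy hxy ⟨b + -a, ?_, ?_⟩
    · apply pn_add_lt hp h hε.le
      rw [pn_neg h, ← hσp]
      exact add_lt_add (Real.rpow_lt_rpow (h.nonneg _) hb' hp) (Real.rpow_lt_rpow (h.nonneg _) ha' hp)
    · rw [map_add, map_neg, ha, hb]; beta_reduce; abel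
  have hsub : (⋃ x ∈ s, A x) ⊆ W N f R τ := by
    refine Set.iUnion₂_subset fun x hx => ?_
    rintro v ⟨hv, a, ha, ha'⟩
    refine ⟨?_, x + a, by rw [map_add, ha]; beta_reduce; abel, ?_⟩
    · have e : v = (v + -f x) + f x := by abel
      rw [e]
      refine (norm_add_le _ _).trans_lt ?_
      have := hRx x hx
      simp only at hv
      nlinarith
    · apply pn_add_lt hp h hτ0.le
      rw [hτp]
      have h1 := Real.rpow_lt_rpow (h.nonneg _) (hs x hx) hp
      have h2 := Real.rpow_lt_rpow (h.nonneg _) (ha'.trans_le hσ1) hp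
      rw [Real.one_rpow] at h1 h2
      linarith
  have hm := MeasureTheory.measure_mono (μ := MeasureTheory.volume) hsub
  rw [MeasureTheory.measure_biUnion_finset hdisj (fun x _ => (hAo x).measurableSet)] at hm
  simp only [hAv, Finset.sum_const, nsmul_eq_mul] at hm
  rw [W_vol h f R hσ0, W_vol h f R hτ0, ← mul_assoc] at hm
  have hpos : MeasureTheory.volume (W N f R 1) ≠ 0 := by
    refine (W_open hp h f hf R one_pos).measure_ne_zero _ ⟨0, ?_, 0, map_zero _, ?_⟩
    · simpa using hR0
    · rw [pn_zero h]; norm_num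
  have hfin : MeasureTheory.volume (W N f R 1) ≠ ⊤ := by
    refine (lt_of_le_of_lt (MeasureTheory.measure_mono ?_)
      (MeasureTheory.measure_ball_lt_top (x := (0 : Fin d → ℝ)) (r := R))).ne
    rintro v ⟨hv, -⟩
    simpa using hv
  rw [ENNReal.mul_le_mul_iff_left hpos hfin, ← ENNReal.ofReal_natCast,
    ← ENNReal.ofReal_mul (by positivity), ENNReal.ofReal_le_ofReal_iff (by positivity)] at hm
  have : (2 ^ (2 / p) / ε : ℝ) = τ / σ := by
    rw [hττ, hσ]; field_simp
  rw [this, div_pow, le_div_iff₀ (by positivity)]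
  exact hm

lemma net {p : ℝ} (hp : 0 < p) (hp1 : p ≤ 1) {N : X → ℝ} (h : IsPNorm p N) {d : ℕ}
    (f : X →ₗ[ℝ] (Fin d → ℝ)) (hf : Function.Surjective f) {ε : ℝ} (hε : 0 < ε) (hε1 : ε ≤ 1) :
    ∃ s : Finset X, (s.card : ℝ) ≤ (2 ^ (2 / p) / ε) ^ d ∧ (∀ x ∈ s, N x < 1) ∧
      ∀ x, N x < 1 → ∃ y ∈ s, ∃ z, N z < ε ∧ f z = f x - f y := by
  classical
  by_contra hcon
  push Not at hcon
  have key : ∀ n : ℕ, ∃ s : Finset X, s.card = n ∧ (∀ x ∈ s, N x < 1) ∧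
      ∀ x ∈ s, ∀ y ∈ s, x ≠ y → ¬ ∃ z, N z < ε ∧ f z = f x - f y := by
    intro n
    induction n with
    | zero => exact ⟨∅, by simp⟩
    | succ n ih =>
      obtain ⟨s, hc, hs, hsep⟩ := ih
      obtain ⟨x, hx, H⟩ := hcon s (packing hp hp1 h f hf hε hε1 s hs hsep) hs
      have hxs : x ∉ s := fun hxs => H x hxs 0 (by rwa [pn_zero h]) (by simp)
      refine ⟨insert x s, by rw [Finset.card_insert_of_notMem hxs, hc], ?_, ?_⟩
      · intro y hy
        rcases Finset.mem_insert.1 hy with rfl | hy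
        exacts [hx, hs y hy]
      · intro a ha b hb hab
        rcases Finset.mem_insert.1 ha with rfl | ha2 <;> rcases Finset.mem_insert.1 hb with rfl | hb2
        · exact absurd rfl hab
        · rintro ⟨z, hz, hz'⟩
          exact H b hb2 z hz hz'
        · rintro ⟨z, hz, hz'⟩
          refine H a ha2 (-z) (by rwa [pn_neg h]) ?_
          rw [map_neg, hz']; abel
        · exact hsep a ha2 b hb2 hab
  obtain ⟨n, hn⟩ := exists_nat_gt ((2 ^ (2 / p) / ε : ℝ) ^ d)
  obtain ⟨s, hc, hs, hsep⟩ := key n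
  have := packing hp hp1 h f hf hε hε1 s hs hsep
  rw [hc] at this
  linarith

/-- Covering of `T(B_X)` by at most `m` closed balls of radius `ρ`. -/
def Cov (NX : X → ℝ) (NY : Y → ℝ) (T : X →ₗ[ℝ] Y) (m : ℕ) (ρ : ℝ) : Prop :=
  ∃ s : Finset Y, s.card ≤ m ∧ ∀ x, NX x < 1 → ∃ c ∈ s, NY (T x - c) ≤ ρ

lemma step {p q : ℝ} (hp : 0 < p) (hp1 : p ≤ 1) (hq : 0 < q) {NX : X → ℝ} {NY : Y → ℝ}
    (hX : IsPNorm p NX) (hY : IsPNorm q NY) (T : X →ₗ[ℝ] Y) {θ ρ : ℝ} (hθ : 1 ≤ θ) (hρ : 0 ≤ ρ)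
    {m K L : ℕ} (M : Submodule ℝ X) (hM : Module.rank ℝ (X ⧸ M) < (K : Cardinal))
    (hMT : ∀ x ∈ M, NX x ≤ 1 → NY (T x) ≤ ρ)
    (hL : ((2 : ℝ) ^ (2 / p) * (θ * 2 ^ (1 / q))) ^ K ≤ L)
    (hcov : Cov NX NY T m (2 ^ (1 / q) * 3 ^ (1 / p) * (θ * ρ))) :
    Cov NX NY T (L * m) (2 ^ (1 / q) * 3 ^ (1 / p) * ρ) := by
  classical
  obtain ⟨s, hsc, hs⟩ := hcov
  have hfin : Module.Finite ℝ (X ⧸ M) :=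
    Module.rank_lt_aleph0_iff.1 (hM.trans (Cardinal.natCast_lt_aleph0))
  have hd : Module.finrank ℝ (X ⧸ M) < K := by
    rw [← Module.finrank_eq_rank] at hM
    exact_mod_cast hM
  set d := Module.finrank ℝ (X ⧸ M)
  let b : Module.Basis (Fin d) ℝ (X ⧸ M) := Module.finBasis ℝ (X ⧸ M)
  let f : X →ₗ[ℝ] (Fin d → ℝ) := b.equivFun.toLinearMap ∘ₗ M.mkQ
  have hf : Function.Surjective f := b.equivFun.surjective.comp M.mkQ_surjective
  have hker : ∀ x, f x = 0 → x ∈ M := by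
    intro x hx
    have : M.mkQ x = 0 := b.equivFun.map_eq_zero_iff.1 hx
    simpa using this
  set κ : ℝ := 2 ^ (1 / q) with hκ
  have hκ1 : 1 ≤ κ := Real.one_le_rpow (by norm_num) (by positivity)
  have hκq : κ ^ q = 2 := by
    rw [hκ, ← Real.rpow_mul (by norm_num), one_div_mul_cancel hq.ne', Real.rpow_one]
  set C : ℝ := 3 ^ (1 / p) with hC
  have hC1 : 1 ≤ C := Real.one_le_rpow (by norm_num) (by positivity)
  have hCp : C ^ p = 3 := by
    rw [hC, ← Real.rpow_mul (by norm_num), one_div_mul_cancel hp.ne', Real.rpow_one]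
  have hκ0 : 0 < κ := by linarith
  have hC0 : 0 < C := by linarith
  have hθ0 : 0 < θ := by linarith
  have hθκ : 1 ≤ θ * κ := one_le_mul_of_one_le_of_one_le hθ hκ1
  set ε : ℝ := (θ * κ)⁻¹ with hεd
  have hε : 0 < ε := by positivity
  have hε1 : ε ≤ 1 := inv_le_one_of_one_le₀ hθκ
  obtain ⟨t, htc, ht1, ht⟩ := net hp hp1 hX f hf hε hε1
  have htL : t.card ≤ L := by
    have h1 : (1:ℝ) ≤ 2 ^ (2 / p) * (θ * κ) :=
      one_le_mul_of_one_le_of_one_le (Real.one_le_rpow (by norm_num) (by positivity)) hθκ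
    have h2 : (2:ℝ) ^ (2 / p) / ε = 2 ^ (2 / p) * (θ * κ) := by
      rw [hεd, div_inv_eq_mul]
    rw [h2] at htc
    exact_mod_cast htc.trans ((pow_le_pow_right₀ h1 hd.le).trans hL)
  refine ⟨Finset.image₂ (fun y c => T y + ε • c) t s,
    (Finset.card_image₂_le _ _ _).trans (Nat.mul_le_mul htL hsc), fun x hx => ?_⟩
  obtain ⟨y, hy, z, hz, hfz⟩ := ht x hx
  obtain ⟨c, hc, hcz⟩ := hs (ε⁻¹ • z) (by
    rw [hX.smul_eq, abs_of_pos (inv_pos.2 hε), inv_mul_lt_iff₀ hε]; linarith)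
  refine ⟨T y + ε • c, Finset.mem_image₂_of_mem hy hc, ?_⟩
  set w := x + (-y + -z) with hw
  have hwM : w ∈ M := hker _ (by rw [hw, map_add, map_add, map_neg, map_neg, hfz]; abel)
  have hwC : NX w ≤ C := by
    apply pn_add_le hp hX hC0.le
    rw [hCp]
    have h0 := hX.padd (-y) (-z)
    rw [pn_neg hX, pn_neg hX] at h0
    have h1 := Real.rpow_lt_rpow (hX.nonneg _) hx hp
    have h2 := Real.rpow_lt_rpow (hX.nonneg _) (ht1 y hy) hp
    have h3 := Real.rpow_lt_rpow (hX.nonneg _) (hz.trans_le hε1) hp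
    rw [Real.one_rpow] at h1 h2 h3
    linarith
  have hTw : NY (T w) ≤ C * ρ := by
    have := hMT (C⁻¹ • w) (M.smul_mem _ hwM) (by
      rw [hX.smul_eq, abs_of_pos (inv_pos.2 hC0), inv_mul_le_iff₀ hC0]; linarith)
    rwa [map_smul, hY.smul_eq, abs_of_pos (inv_pos.2 hC0), inv_mul_le_iff₀ hC0] at this
  have hTz : NY (T z - ε • c) ≤ C * ρ := by
    have e : T z - ε • c = ε • (T (ε⁻¹ • z) - c) := by
      rw [smul_sub, map_smul, smul_smul, mul_inv_cancel₀ hε.ne', one_smul]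
    rw [e, hY.smul_eq, abs_of_pos hε]
    calc ε * NY (T (ε⁻¹ • z) - c) ≤ ε * (κ * C * (θ * ρ)) := by gcongr
      _ = C * ρ := by rw [hεd]; field_simp
  have e : T x - (T y + ε • c) = T w + (T z - ε • c) := by
    rw [hw, map_add, map_add, map_neg, map_neg]; abel
  rw [e]
  apply pn_add_le hq hY (by positivity)
  rw [mul_assoc, Real.mul_rpow hκ0.le (by positivity), hκq]
  have h1 := Real.rpow_le_rpow (hY.nonneg _) hTw hq.le
  have h2 := Real.rpow_le_rpow (hY.nonneg _) hTz hq.le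
  linarith

lemma top_of_rank {M : Submodule ℝ X} (hM : Module.rank ℝ (X ⧸ M) < ((1 : ℕ) : Cardinal)) :
    M = ⊤ := by
  have h0 : Module.rank ℝ (X ⧸ M) = 0 := by
    rwa [Nat.cast_one, Cardinal.lt_one_iff] at hM
  have := rank_zero_iff.1 h0
  exact Submodule.Quotient.subsingleton_iff.1 this

lemma entropy_le {q : ℝ} {NX : X → ℝ} {NY : Y → ℝ} (hX0 : NX 0 = 0)
    (T : X →ₗ[ℝ] Y) {m k : ℕ} {ρ ρ' : ℝ} (hρ : 0 < ρ') (hlt : ρ < ρ')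
    (hm : m ≤ 2 ^ (k - 1)) (hcov : Cov NX NY T m ρ) : entropyNumber NX NY T k ≤ ρ' := by
  classical
  obtain ⟨s, hsc, hs⟩ := hcov
  refine csInf_le ⟨0, fun _ h => h.1.le⟩ ⟨hρ, ?_⟩
  obtain ⟨c0, hc0, -⟩ := hs 0 (by rw [hX0]; norm_num)
  refine ⟨fun i => if h : i.1 < s.card then (s.equivFin.symm ⟨i.1, h⟩ : Y) else c0, fun x hx => ?_⟩
  obtain ⟨c, hc, hcx⟩ := hs x hx
  have hlt' : (s.equivFin ⟨c, hc⟩).1 < s.card := (s.equivFin ⟨c, hc⟩).2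
  refine ⟨⟨(s.equivFin ⟨c, hc⟩).1, hlt'.trans_le (hsc.trans hm)⟩, ?_⟩
  simp only [hlt', dif_pos, Fin.eta, Equiv.symm_apply_apply]
  exact hcx.trans_lt hlt

end CarlQB

open CarlQB in
theorem carl_inequality_quasiBanach.{u, v} (p q α : ℝ)
    (hp0 : 0 < p) (hp1 : p ≤ 1) (hq0 : 0 < q) (hq1 : q ≤ 1) (hα : 0 < α) :
    ∃ γ : ℝ, 0 < γ ∧
      ∀ (X : Type u) (Y : Type v) [AddCommGroup X] [Module ℝ X] [AddCommGroup Y] [Module ℝ Y]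
        (NX : X → ℝ) (NY : Y → ℝ), IsPNorm p NX → IsPNorm q NY →
        ∀ T : X →ₗ[ℝ] Y, (∃ C : ℝ, ∀ x, NX x ≤ 1 → NY (T x) ≤ C) →
        ∀ n : ℕ,
          sSup ((fun k : ℕ => (k : ℝ) ^ α * entropyNumber NX NY T k) '' Set.Icc 1 n)
            ≤ γ * sSup ((fun k : ℕ => (k : ℝ) ^ α * gelfandNumber NX NY T k) '' Set.Icc 1 n) := by
  set θ : ℝ := 2 ^ α with hθd
  have hθ : 1 ≤ θ := Real.one_le_rpow (by norm_num) hα.le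
  have hθ0 : 0 < θ := by linarith
  set D : ℝ := (2 : ℝ) ^ (2 / p) * (θ * 2 ^ (1 / q)) with hD
  have hD0 : 0 < D := by positivity
  obtain ⟨A, hA1, hA⟩ : ∃ A : ℕ, 1 ≤ A ∧ D ^ 2 ≤ 2 ^ A := by
    obtain ⟨a, ha⟩ := pow_unbounded_of_one_lt (D ^ 2) (by norm_num : (1:ℝ) < 2)
    exact ⟨a + 1, by omega, ha.le.trans (pow_le_pow_right₀ (by norm_num) (by omega))⟩
  set R : ℝ := 2 ^ (1 / q) * 3 ^ (1 / p) with hR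
  have hR1 : 1 ≤ R := one_le_mul_of_one_le_of_one_le
    (Real.one_le_rpow (by norm_num) (by positivity)) (Real.one_le_rpow (by norm_num) (by positivity))
  have hR0 : 0 < R := by linarith
  have hA0 : (0:ℝ) < A := by exact_mod_cast hA1
  refine ⟨2 * R * (4 * A) ^ α, by positivity, ?_⟩
  intro X Y _ _ _ _ NX NY hX hY T ⟨C, hC⟩ n
  set γ : ℝ := 2 * R * (4 * A) ^ α with hγ
  have hγ0 : 0 < γ := by positivity
  set S := sSup ((fun k : ℕ => (k : ℝ) ^ α * gelfandNumber NX NY T k) '' Set.Icc 1 n) with hS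
  have hg0 : ∀ k, 0 ≤ gelfandNumber NX NY T k := by
    intro k
    apply Real.sInf_nonneg
    rintro r ⟨M, -, hM⟩
    have := hM 0 M.zero_mem (by rw [pn_zero hX]; norm_num)
    rwa [map_zero, pn_zero hY] at this
  have hS0 : 0 ≤ S := by
    apply Real.sSup_nonneg
    rintro _ ⟨k, -, rfl⟩
    have := hg0 k
    positivity
  have hbdd : BddAbove ((fun k : ℕ => (k : ℝ) ^ α * gelfandNumber NX NY T k) '' Set.Icc 1 n) :=
    ((Set.finite_Icc 1 n).image _).bddAbove
  apply Real.sSup_le _ (by positivity)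
  rintro _ ⟨k, ⟨hk1, hkn⟩, rfl⟩
  simp only
  apply le_of_forall_pos_le_add
  intro η hη
  set lam : ℝ := S + η / γ with hlam
  have hSl : S < lam := by have : 0 < η / γ := by positivity
                           linarith
  have hl0 : 0 < lam := by linarith
  have hgoal : γ * S + η = γ * lam := by rw [hlam]; field_simp
  rw [hgoal]
  -- subspaces
  have hsub : ∀ i : ℕ, 1 ≤ i → i ≤ n → ∃ M : Submodule ℝ X,
      Module.rank ℝ (X ⧸ M) < (i : Cardinal) ∧ ∀ x ∈ M, NX x ≤ 1 → NY (T x) ≤ lam / (i : ℝ) ^ α := by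
    intro i hi1 hin
    have hi0 : (0:ℝ) < i := by exact_mod_cast hi1
    have h1 : (i : ℝ) ^ α * gelfandNumber NX NY T i ≤ S := le_csSup hbdd ⟨i, ⟨hi1, hin⟩, rfl⟩
    have h2 : gelfandNumber NX NY T i < lam / (i : ℝ) ^ α := by
      rw [lt_div_iff₀ (by positivity)]; linarith
    have hne : {r : ℝ | ∃ M : Submodule ℝ X, Module.rank ℝ (X ⧸ M) < (i : Cardinal) ∧
        ∀ x ∈ M, NX x ≤ 1 → NY (T x) ≤ r}.Nonempty := by
      refine ⟨C, ⊤, ?_, fun x _ => hC x⟩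
      rw [rank_subsingleton']
      exact_mod_cast hi1
    obtain ⟨r, ⟨M, hM, hMr⟩, hr⟩ := exists_lt_of_csInf_lt hne h2
    exact ⟨M, hM, fun x hx hx1 => (hMr x hx hx1).trans hr.le⟩
  have hpow : ∀ j : ℕ, (((2 ^ j : ℕ) : ℝ)) ^ α = θ ^ j := by
    intro j
    rw [hθd, Nat.cast_pow, Nat.cast_ofNat, ← Real.rpow_natCast, ← Real.rpow_natCast,
      ← Real.rpow_mul (by norm_num), ← Real.rpow_mul (by norm_num), mul_comm]
  have hbase : Cov NX NY T 1 (R * lam) := by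
    obtain ⟨M, hM, hMT⟩ := hsub 1 le_rfl (hk1.trans hkn)
    have := top_of_rank hM
    subst this
    refine ⟨{0}, by simp, fun x hx => ⟨0, by simp, ?_⟩⟩
    have h1 := hMT x trivial hx.le
    simp only [Nat.cast_one, Real.one_rpow, div_one] at h1
    rw [sub_zero]
    nlinarith
  have hind : ∀ j : ℕ, 2 ^ j ≤ n → Cov NX NY T (2 ^ (A * 2 ^ j)) (R * (lam / θ ^ j)) := by
    intro j
    induction j with
    | zero =>
      intro _
      obtain ⟨s, hs, hs'⟩ := hbase
      refine ⟨s, hs.trans Nat.one_le_two_pow, ?_⟩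
      simpa using hs'
    | succ j ih =>
      intro hj
      have hj' : 2 ^ j ≤ n := le_trans (Nat.pow_le_pow_right (by norm_num) (by omega)) hj
      obtain ⟨M, hM, hMT⟩ := hsub (2 ^ (j + 1)) Nat.one_le_two_pow hj
      rw [hpow] at hMT
      have hprev := ih hj'
      have e : lam / θ ^ j = θ * (lam / θ ^ (j + 1)) := by
        rw [pow_succ]; field_simp
      rw [e] at hprev
      have := step hp0 hp1 hq0 hX hY T hθ (ρ := lam / θ ^ (j + 1)) (by positivity)
        (L := 2 ^ (A * 2 ^ j)) M hM hMT ?_ hprev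
      · rw [← pow_add] at this
        have e2 : A * 2 ^ (j + 1) = A * 2 ^ j + A * 2 ^ j := by ring
        rw [e2]
        exact this
      · rw [← hD, pow_succ, mul_comm (2 ^ j) 2, pow_mul, Nat.cast_pow, Nat.cast_ofNat, pow_mul]
        gcongr
  have hk0 : (0:ℝ) < k := by exact_mod_cast hk1
  have hka : 0 < (k:ℝ) ^ α := by positivity
  have hX0 := pn_zero hX
  by_cases hkA : k - 1 < A
  · have h1 : entropyNumber NX NY T k ≤ 2 * (R * lam) :=
      entropy_le (q := q) hX0 T (by positivity) (by nlinarith [mul_pos hR0 hl0]) Nat.one_le_two_pow hbase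
    have h2 : (k:ℝ) ^ α ≤ (4 * A) ^ α := by
      apply Real.rpow_le_rpow hk0.le _ hα.le
      have : k ≤ A := by omega
      have : (k:ℝ) ≤ A := by exact_mod_cast this
      linarith
    calc (k:ℝ) ^ α * entropyNumber NX NY T k ≤ (4 * A) ^ α * (2 * (R * lam)) := by
          refine (mul_le_mul_of_nonneg_left h1 hka.le).trans ?_
          gcongr
      _ = γ * lam := by rw [hγ]; ring
  · push Not at hkA
    have hq1 : (k - 1) / A ≠ 0 := by
      have : 1 ≤ (k - 1) / A := (Nat.one_le_div_iff (by omega)).2 hkA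
      omega
    set j := Nat.log 2 ((k - 1) / A) with hj
    have hj1 : 2 ^ j ≤ (k - 1) / A := Nat.pow_log_le_self 2 hq1
    have hj2 : (k - 1) / A < 2 ^ (j + 1) := Nat.lt_pow_succ_log_self (by norm_num) _
    have hj3 : A * 2 ^ j ≤ k - 1 := by
      have := (Nat.le_div_iff_mul_le (by omega)).1 hj1
      linarith
    have hj4 : k - 1 < 2 ^ (j + 1) * A := (Nat.div_lt_iff_lt_mul (by omega)).1 hj2
    have hjn : 2 ^ j ≤ n := by
      have : 2 ^ j ≤ A * 2 ^ j := Nat.le_mul_of_pos_left _ hA1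
      omega
    have hpos : 0 < R * (lam / θ ^ j) := by positivity
    have h1 : entropyNumber NX NY T k ≤ 2 * (R * (lam / θ ^ j)) :=
      entropy_le (q := q) hX0 T (by positivity) (by linarith)
        (Nat.pow_le_pow_right (by norm_num) hj3) (hind j hjn)
    have h2 : (k:ℝ) ^ α ≤ (4 * A) ^ α * θ ^ j := by
      rw [← hpow, ← Real.mul_rpow (by positivity) (by positivity)]
      apply Real.rpow_le_rpow hk0.le _ hα.le
      have h3 : k ≤ 4 * A * 2 ^ j := by
        have e : 2 ^ (j + 1) * A = 2 * (A * 2 ^ j) := by ring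
        have e' : 4 * A * 2 ^ j = 4 * (A * 2 ^ j) := by ring
        omega
      exact_mod_cast h3
    calc (k:ℝ) ^ α * entropyNumber NX NY T k
        ≤ ((4 * A) ^ α * θ ^ j) * (2 * (R * (lam / θ ^ j))) := by
          refine (mul_le_mul_of_nonneg_left h1 hka.le).trans ?_
          gcongr
      _ = γ * lam := by rw [hγ]; field_simp
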